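/- Let p be a prime and s, n positive integers with s ∣ n. Let u, d be positive integers such that u ≡ p^{j₀} (mod p^s − 1) for some 0 ≤ j₀ ≤ s−1, gcd(u, p^n − 1) = 1, and d·u ≡ 1 (mod p^n − 1). Let ∘ be a presemifield multiplication on L admitting a dual ⋆ that is right K-linear. Let α ∈ L with α ≠ 0 and i₀ ∈ K, and let b : L × L → L satisfy b(x,0) = 0 for all x ∈ L and b(x,y) ∘ y^d = x for all y ∈ L \ {0} and x ∈ L. Define G : L × L → K by G(x,y) = Tr^n_s(α·b(x,y)) + i₀·(1 − y^{p^n − 1}) (this value lies in K). Then G is a vectorial dual-bent function satisfying Condition A with ε = 1: there exists G* : L × L → K such that for every c ∈ K \ {0} and every (w,v) ∈ L × L, W_{G_c}(w,v) = p^n·ζ_p^{Tr^s_1(c·G*(w,v))}. -/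

import Mathlib

open Finset

/-- `ζ_p^t = exp(2πi·t.val/p)` for `t : ZMod p`. -/
noncomputable def zetaP (p : ℕ) (t : ZMod p) : ℂ :=
  Complex.exp (2 * Real.pi * Complex.I * (t.val : ℂ) / (p : ℂ))

noncomputable instance (p n : ℕ) [Fact p.Prime] : Fintype (GaloisField p n) :=
  Fintype.ofFinite _

/-- The absolute trace of `GaloisField p n` down to `ZMod p`. -/
noncomputable def absTr (p n : ℕ) [Fact p.Prime] (x : GaloisField p n) : ZMod p :=
  Algebra.trace (ZMod p) (GaloisField p n) x

/-- The relative trace to the `p^s`-element subfield of `GaloisField p n`,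
`x ↦ ∑_{j=0}^{n/s−1} x^{(p^s)^j}`, as an element of `GaloisField p n`. -/
noncomputable def relTr (p n s : ℕ) [Fact p.Prime] (x : GaloisField p n) : GaloisField p n :=
  ∑ j ∈ Finset.range (n / s), x ^ (p ^ s) ^ j

theorem zetaP_eq_stdAddChar (p : ℕ) [NeZero p] (t : ZMod p) :
    zetaP p t = ZMod.stdAddChar t := by
  rw [ZMod.stdAddChar_apply, ZMod.toCircle_apply, zetaP]

theorem absTr_add (p n : ℕ) [Fact p.Prime] (x y : GaloisField p n) :
    absTr p n (x + y) = absTr p n x + absTr p n y :=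
  map_add _ x y

theorem absTr_neg (p n : ℕ) [Fact p.Prime] (x : GaloisField p n) :
    absTr p n (-x) = -absTr p n x :=
  map_neg _ x

theorem absTr_sub (p n : ℕ) [Fact p.Prime] (x y : GaloisField p n) :
    absTr p n (x - y) = absTr p n x - absTr p n y :=
  map_sub _ x y

theorem fintypeCard_galoisField (p : ℕ) [Fact p.Prime] {n : ℕ} (hn : n ≠ 0) :
    Fintype.card (GaloisField p n) = p ^ n := by
  rw [Fintype.card_eq_nat_card, GaloisField.card p n hn]

/-- Orthogonality relations for the additive characters of a finite field. -/
theorem sum_zetaP_absTr_mul (p : ℕ) [Fact p.Prime] {n : ℕ} (hn : n ≠ 0) (a : GaloisField p n)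
    [Decidable (a = 0)] :
    ∑ x, zetaP p (absTr p n (x * a)) = if a = 0 then (p : ℂ) ^ n else 0 := by
  classical
  let ψ : AddChar (GaloisField p n) ℂ :=
    (ZMod.stdAddChar (N := p)).compAddMonoidHom
      (Algebra.trace (ZMod p) (GaloisField p n)).toAddMonoidHom
  have hψ : ψ ≠ 1 := by
    intro h
    obtain ⟨x, hx⟩ := Algebra.trace_surjective (ZMod p) (GaloisField p n) 1
    have h1 : ZMod.stdAddChar (1 : ZMod p) = 1 := by
      rw [← hx]
      exact DFunLike.congr_fun h x
    rw [← (ZMod.stdAddChar (N := p)).map_zero_eq_one] at h1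
    exact one_ne_zero (ZMod.injective_stdAddChar h1)
  have key := AddChar.sum_mulShift a (AddChar.IsPrimitive.of_ne_one hψ)
  rw [fintypeCard_galoisField p hn] at key
  have hterm : ∀ x, zetaP p (absTr p n (x * a)) = ψ (x * a) :=
    fun x => zetaP_eq_stdAddChar p _
  simp only [hterm, key]
  split_ifs <;> simp

/-- The trace form of a finite field over its prime field is nondegenerate. -/
theorem eq_of_absTr_mul_eq (p : ℕ) [Fact p.Prime] (n : ℕ) {a a' : GaloisField p n}
    (h : ∀ x, absTr p n (x * a) = absTr p n (x * a')) : a = a' := by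
  have hnd := (traceForm_nondegenerate (ZMod p) (GaloisField p n)).1 (a - a')
  refine sub_eq_zero.mp (hnd fun x => ?_)
  rw [Algebra.traceForm_apply, mul_comm, mul_sub, map_sub]
  exact sub_eq_zero.mpr (h x)

theorem absTr_pow_prime_pow (p n : ℕ) [Fact p.Prime] (x : GaloisField p n) (k : ℕ) :
    absTr p n (x ^ p ^ k) = absTr p n x := by
  induction k with
  | zero => simp
  | succ k ih =>
    rw [← ih, pow_succ, pow_mul]
    have h := Algebra.trace_eq_of_algEquiv
      (FiniteField.frobeniusAlgEquivOfAlgebraic (ZMod p) (GaloisField p n)) (x ^ p ^ k)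
    rw [FiniteField.coe_frobeniusAlgEquivOfAlgebraic, ZMod.card] at h
    exact h

/-- The relative trace takes values in the subfield, and is compatible with the absolute traces. -/
theorem exists_relTr_factor (p : ℕ) [Fact p.Prime] {n s : ℕ} (hn : n ≠ 0) (hs : s ≠ 0)
    (ι : GaloisField p s →+* GaloisField p n) :
    ∃ T : GaloisField p n → GaloisField p s, (∀ z, ι (T z) = relTr p n s z) ∧
      ∀ c z, absTr p s (c * T z) = absTr p n (ι c * z) := by
  let : Algebra (GaloisField p s) (GaloisField p n) := ι.toAlgebra
  have : IsScalarTower (ZMod p) (GaloisField p s) (GaloisField p n) :=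
    IsScalarTower.of_algebraMap_eq' (Subsingleton.elim _ _)
  have : Module.Finite (GaloisField p s) (GaloisField p n) := Module.Finite.of_finite
  have hrank : Module.finrank (GaloisField p s) (GaloisField p n) = n / s := by
    have h := Module.finrank_mul_finrank (ZMod p) (GaloisField p s) (GaloisField p n)
    rw [GaloisField.finrank p hs, GaloisField.finrank p hn] at h
    exact Nat.eq_div_of_mul_eq_right hs h
  refine ⟨fun z => Algebra.trace (GaloisField p s) (GaloisField p n) z, fun z => ?_,
    fun c z => ?_⟩
  · have h := FiniteField.algebraMap_trace_eq_sum_pow (GaloisField p s) (GaloisField p n) z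
    rw [hrank, GaloisField.card p s hs] at h
    exact h
  · rw [← smul_eq_mul, ← map_smul, Algebra.smul_def]
    exact Algebra.trace_trace (R := ZMod p) (S := GaloisField p s) (ι c * z)

theorem pow_eq_self_of_modEq_one (p : ℕ) [Fact p.Prime] {n k : ℕ} (hn : n ≠ 0)
    (hk : k ≡ 1 [MOD p ^ n - 1]) {y : GaloisField p n} (hy : y ≠ 0) : y ^ k = y := by
  have h1 : y ^ (p ^ n - 1) = 1 := by
    rw [← fintypeCard_galoisField p hn]
    exact FiniteField.pow_card_sub_one_eq_one y hy
  simpa using pow_eq_pow_of_modEq hk h1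

theorem stmt5 (p : ℕ) [Fact p.Prime] (n s : ℕ) (hn : 0 < n) (hs : 0 < s) (hsn : s ∣ n)
    (u d : ℕ) (hu : 0 < u) (hd : 0 < d)
    (j₀ : ℕ) (hj₀ : j₀ < s) (hmod : u ≡ p ^ j₀ [MOD p ^ s - 1])
    (hgcd : Nat.gcd u (p ^ n - 1) = 1) (hdu : d * u ≡ 1 [MOD p ^ n - 1])
    -- a presemifield multiplication `∘` on `L = GaloisField p n`
    (mul : GaloisField p n → GaloisField p n → GaloisField p n)
    (hmul_addl : ∀ x y z, mul (x + y) z = mul x z + mul y z)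
    (hmul_addr : ∀ x y z, mul z (x + y) = mul z x + mul z y)
    (hmul_zero : ∀ x y, mul x y = 0 → x = 0 ∨ y = 0)
    -- a dual `⋆` of `∘`
    (str : GaloisField p n → GaloisField p n → GaloisField p n)
    (hdual : ∀ x y z, absTr p n (z * mul x y) = absTr p n (x * str z y))
    -- the subfield `K` with `p^s` elements, realized via a ring embedding
    (ι : GaloisField p s →+* GaloisField p n)
    -- `⋆` is right `K`-linear
    (hlin : ∀ (x y : GaloisField p n) (c : GaloisField p s),
      str x (ι c * y) = ι c * str x y)
    (α : GaloisField p n) (hα : α ≠ 0) (i₀ : GaloisField p s)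
    -- the function `b(x,y)` with `b(x,0) = 0` and `b(x,y) ∘ y^d = x` for `y ≠ 0`
    (b : GaloisField p n → GaloisField p n → GaloisField p n)
    (hb0 : ∀ x, b x 0 = 0)
    (hb : ∀ x y, y ≠ 0 → mul (b x y) (y ^ d) = x)
    -- `G(x,y) = Tr^n_s(α·b(x,y)) + i₀·(1 − y^{p^n−1})`, a `K`-valued function
    (G : GaloisField p n → GaloisField p n → GaloisField p s)
    (hG : ∀ x y, ι (G x y) = relTr p n s (α * b x y) + ι i₀ * (1 - y ^ (p ^ n - 1))) :
    -- `G` is vectorial dual-bent satisfying Condition A with `ε = 1`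
    ∃ Gd : GaloisField p n → GaloisField p n → GaloisField p s,
      ∀ c : GaloisField p s, c ≠ 0 → ∀ w v : GaloisField p n,
        (∑ x : GaloisField p n, ∑ y : GaloisField p n,
            zetaP p (absTr p s (c * G x y) - absTr p n (w * x + v * y))) =
          (p : ℂ) ^ n * zetaP p (absTr p s (c * Gd w v)) := by
  classical
  have hn0 := hn.ne'
  have hs0 := hs.ne'
  obtain ⟨T, hT, hTtr⟩ := exists_relTr_factor p hn0 hs0 ι
  have hG0 : ∀ x, G x 0 = i₀ := fun x => ι.injective <| by
    have hpn : p ^ n - 1 ≠ 0 :=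
      (Nat.sub_pos_of_lt (Nat.one_lt_pow hn0 (Fact.out : p.Prime).one_lt)).ne'
    rw [hG, hb0, mul_zero, zero_pow hpn, sub_zero, mul_one, ← hT, add_eq_right]
    have : T 0 = 0 := eq_of_absTr_mul_eq p s fun c => by rw [hTtr, mul_zero, mul_zero]; simp [absTr]
    rw [this, map_zero]
  have hG1 : ∀ x y, y ≠ 0 → G x y = T (α * b x y) := fun x y hy => ι.injective <| by
    have h1 : y ^ (p ^ n - 1) = 1 := by
      rw [← fintypeCard_galoisField p hn0]
      exact FiniteField.pow_card_sub_one_eq_one y hy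
    rw [hG, h1, sub_self, mul_zero, add_zero, hT]
  have hmul_inj : ∀ e, e ≠ 0 → Function.Injective fun z => mul z e := by
    intro e he z z' h
    have h0 : mul (z - z') e = 0 := by
      have := hmul_addl (z - z') z' e
      rw [sub_add_cancel] at this
      rw [← sub_eq_of_eq_add this]
      exact sub_eq_zero.mpr h
    exact sub_eq_zero.mp ((hmul_zero _ _ h0).resolve_right he)
  have hmul_bij : ∀ e, e ≠ 0 → Function.Bijective fun z => mul z e :=
    fun e he => Finite.injective_iff_bijective.mp (hmul_inj e he)
  have hstr_add : ∀ z y y', str z (y + y') = str z y + str z y' := fun z y y' =>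
    eq_of_absTr_mul_eq p n fun x => by
      rw [mul_add, absTr_add, ← hdual, ← hdual, ← hdual, hmul_addr, mul_add, absTr_add]
  have hstr_zero_left : ∀ y, str 0 y = 0 := fun y =>
    eq_of_absTr_mul_eq p n fun x => by rw [← hdual, zero_mul, mul_zero]
  have hstr_zero : ∀ z, str z 0 = 0 := fun z => by simpa using hlin z 0 0
  have hstr_inj : ∀ w, w ≠ 0 → Function.Injective (str w) := by
    intro w hw y y' h
    have h0 : str w (y - y') = 0 := by
      have := hstr_add w (y - y') y'
      rw [sub_add_cancel] at this
      rw [← sub_eq_of_eq_add this]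
      exact sub_eq_zero.mpr h
    by_contra hne
    refine hw (eq_of_absTr_mul_eq p n fun t => ?_)
    obtain ⟨x, rfl⟩ := (hmul_bij _ (sub_ne_zero.mpr hne)).2 t
    rw [mul_comm, hdual, h0, mul_zero, mul_zero]
  have hY : ∀ w, ∃ y, w ≠ 0 → str w y = α := by
    intro w
    by_cases hw : w = 0
    · exact ⟨0, fun h => absurd hw h⟩
    · obtain ⟨y, hy⟩ := Finite.surjective_of_injective (hstr_inj w hw) α
      exact ⟨y, fun _ => hy⟩
  choose Y hY using hY
  have hYne : ∀ w, w ≠ 0 → Y w ≠ 0 := fun w hw h0 => hα <| by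
    rw [← hY w hw, h0, hstr_zero]
  refine ⟨fun w v => if w = 0 then i₀ else -T ((v * Y w ^ u) ^ p ^ (s - j₀)), ?_⟩
  intro c hc w v
  have hιc : ι c ≠ 0 := (map_ne_zero ι).mpr hc
  have hsum0 : ∑ x, zetaP p (absTr p s (c * G x 0) - absTr p n (w * x + v * 0)) =
      if w = 0 then (p : ℂ) ^ n * zetaP p (absTr p s (c * i₀)) else 0 := by
    have hterm : ∀ x, zetaP p (absTr p s (c * G x 0) - absTr p n (w * x + v * 0)) =
        zetaP p (absTr p s (c * i₀)) * zetaP p (absTr p n (x * -w)) := by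
      intro x
      rw [hG0, zetaP_eq_stdAddChar, zetaP_eq_stdAddChar, zetaP_eq_stdAddChar,
        ← AddChar.map_add_eq_mul, sub_eq_add_neg, ← absTr_neg]
      congr 3
      ring
    simp only [hterm, ← Finset.mul_sum, sum_zetaP_absTr_mul p hn0, neg_eq_zero]
    split_ifs <;> ring
  have hsum1 : ∀ y, y ≠ 0 →
      ∑ x, zetaP p (absTr p s (c * G x y) - absTr p n (w * x + v * y)) =
        if str w (y ^ d) = ι c * α then (p : ℂ) ^ n * zetaP p (-absTr p n (v * y)) else 0 := by
    intro y hy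
    have hyd : y ^ d ≠ 0 := pow_ne_zero d hy
    rw [← (Equiv.ofBijective _ (hmul_bij _ hyd)).sum_comp]
    have hterm : ∀ z, zetaP p (absTr p s (c * G (mul z (y ^ d)) y) -
          absTr p n (w * mul z (y ^ d) + v * y)) =
        zetaP p (-absTr p n (v * y)) *
          zetaP p (absTr p n (z * (ι c * α - str w (y ^ d)))) := by
      intro z
      have hbz : b (mul z (y ^ d)) y = z := hmul_inj _ hyd (hb _ y hy)
      rw [hG1 _ _ hy, hbz, hTtr, absTr_add, hdual, mul_sub, absTr_sub, zetaP_eq_stdAddChar,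
        zetaP_eq_stdAddChar, zetaP_eq_stdAddChar, ← AddChar.map_add_eq_mul,
        show ι c * (α * z) = z * (ι c * α) by ring]
      congr 1
      ring
    simp only [Equiv.ofBijective_apply, hterm, ← Finset.mul_sum, sum_zetaP_absTr_mul p hn0,
      sub_eq_zero, eq_comm (a := ι c * α)]
    split_ifs <;> ring
  rw [Finset.sum_comm]
  beta_reduce
  by_cases hw : w = 0
  · rw [Finset.sum_eq_single 0 (fun y _ hy => ?_) (fun h => absurd (Finset.mem_univ _) h), hsum0,
      if_pos hw, if_pos hw]
    rw [hsum1 y hy, if_neg]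
    rw [hw, hstr_zero_left]
    exact (mul_ne_zero hιc hα).symm
  · have hcY : ι c * Y w ≠ 0 := mul_ne_zero hιc (hYne w hw)
    have hiff : ∀ y, y ≠ 0 → (str w (y ^ d) = ι c * α ↔ y = (ι c * Y w) ^ u) := by
      intro y hy
      rw [← hY w hw, ← hlin, (hstr_inj w hw).eq_iff]
      constructor
      · intro h
        rw [← h, ← pow_mul, pow_eq_self_of_modEq_one p hn0 hdu hy]
      · intro h
        rw [h, ← pow_mul, mul_comm u d, pow_eq_self_of_modEq_one p hn0 hdu hcY]
    have hy0 : (ι c * Y w) ^ u ≠ 0 := pow_ne_zero u hcY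
    rw [Finset.sum_eq_single ((ι c * Y w) ^ u) (fun y _ hy => ?_)
      (fun h => absurd (Finset.mem_univ _) h), hsum1 _ hy0, if_pos ((hiff _ hy0).mpr rfl),
      if_neg hw]
    · have hcu : c ^ u = c ^ p ^ j₀ := by
        refine pow_eq_pow_of_modEq hmod ?_
        rw [← fintypeCard_galoisField p hs0]
        exact FiniteField.pow_card_sub_one_eq_one c hc
      have hcs : (c ^ u) ^ p ^ (s - j₀) = c := by
        rw [hcu, ← pow_mul, ← pow_add, Nat.add_sub_cancel' hj₀.le,
          ← fintypeCard_galoisField p hs0, FiniteField.pow_card]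
      rw [mul_neg, absTr_neg, hTtr, ← absTr_pow_prime_pow p n (v * _) (s - j₀)]
      congr 4
      nth_rewrite 2 [← hcs]
      rw [map_pow, map_pow]
      ring
    · by_cases hyz : y = 0
      · rw [hyz, hsum0, if_neg hw]
      · rw [hsum1 y hyz, if_neg (mt (hiff y hyz).mp hy)]
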